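/- arXiv:1907.01471 — 10 statements merged into one kernel-verified Lean document; each statement's English description precedes it below -/
import Mathlib

section
/- Let m₁, m₂, …, m_n be pairwise coprime squarefree integers, each greater than 1. Then the set {√m₁, √m₂, …, √m_n} of real numbers is linearly independent over ℚ. -/
/-- In a Galois extension `K / F`, nonzero elements whose squares lie in `F` and whose pairwise
ratios do not lie in `F` are linearly independent over `F`. -/
theorem linearIndependent_of_sq_mem_bot {F K ι : Type*} [Field F] [Field K] [Algebra F K]
    [IsGalois F K] (x : ι → K) (hx : ∀ i, x i ≠ 0)
    (hsq : ∀ i, x i ^ 2 ∈ (⊥ : IntermediateField F K))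
    (hdiv : ∀ i j, i ≠ j → x i / x j ∉ (⊥ : IntermediateField F K)) :
    LinearIndependent F x := by
  have sign (i : ι) (σ : K ≃ₐ[F] K) : σ (x i) = x i ∨ σ (x i) = -x i := by
    rw [← sq_eq_sq_iff_eq_or_eq_neg, ← map_pow]
    exact (InfiniteGalois.mem_bot_iff_fixed _).1 (hsq i) σ
  let χ (i : ι) : (K ≃ₐ[F] K) →* K :=
    { toFun := fun σ => σ (x i) / x i
      map_one' := div_self (hx i)
      map_mul' := fun σ τ => by
        have h0 := hx i
        rcases sign i σ with hσ | hσ <;> rcases sign i τ with hτ | hτ <;>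
          simp [AlgEquiv.mul_apply, hσ, hτ, neg_div, div_self h0] }
  have χ_inj : Function.Injective χ := by
    intro i j h
    by_contra hij
    refine hdiv i j hij ((InfiniteGalois.mem_bot_iff_fixed _).2 fun σ => ?_)
    have hσ : σ (x i) / x i = σ (x j) / x j := DFunLike.congr_fun h σ
    have hj : σ (x j) ≠ 0 := by simpa using hx j
    have h1 := hx i
    have h2 := hx j
    rw [map_div₀, div_eq_div_iff hj h2]
    rw [div_eq_div_iff h1 h2] at hσ
    rw [hσ, mul_comm]
  have hχ := (linearIndependent_monoidHom (K ≃ₐ[F] K) K).comp χ χ_inj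
  rw [linearIndependent_iff'] at hχ ⊢
  intro s c hc i hi
  have h := hχ s (fun k => algebraMap F K (c k) * x k) (funext fun σ => ?_) i hi
  · simpa [hx i] using h
  · have h := congrArg σ hc
    simp only [map_sum, map_smul, map_zero] at h
    rw [Finset.sum_apply, Pi.zero_apply, ← h]
    refine Finset.sum_congr rfl fun k _ => ?_
    change algebraMap F K (c k) * x k * (σ (x k) / x k) = c k • σ (x k)
    rw [Algebra.smul_def, mul_assoc, mul_div_cancel₀ _ (hx k)]

/-- The ratio of the square roots of two coprime natural numbers, the first of which is
squarefree and greater than `1`, is irrational. -/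
theorem irrational_sqrt_div_sqrt {a b : ℕ} (ha : Squarefree a) (ha1 : 1 < a) (hb : b ≠ 0)
    (hab : Nat.Coprime a b) : Irrational (√(a : ℝ) / √(b : ℝ)) := by
  have hmul : Irrational √((a * b : ℕ) : ℝ) := by
    rw [irrational_sqrt_natCast_iff]
    rintro ⟨r, hr⟩
    obtain ⟨d, hd⟩ := exists_eq_pow_of_mul_eq_pow (Nat.isUnit_iff.2 hab) (hr.trans (sq r).symm)
    have h1 : d = 1 := Nat.isUnit_iff.1 (ha d ⟨1, by rw [hd]; ring⟩)
    simp [h1] at hd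
    omega
  rintro ⟨q, hq⟩
  have hb0 : √(b : ℝ) ≠ 0 := by positivity
  refine hmul ⟨q * b, ?_⟩
  push_cast
  rw [hq, Real.sqrt_mul (Nat.cast_nonneg a), div_mul_eq_mul_div, div_eq_iff hb0, mul_assoc,
    Real.mul_self_sqrt (Nat.cast_nonneg b)]

/-- Let `m₁, …, m_n` be pairwise coprime squarefree integers, each
greater than `1`. Then the family `√m₁, …, √m_n` of real numbers is linearly
independent over `ℚ`. -/
theorem sqrt_linearIndependent
    (n : ℕ) (m : Fin n → ℕ)
    (hsf : ∀ i, Squarefree (m i))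
    (hgt : ∀ i, 1 < m i)
    (hcop : ∀ i j, i ≠ j → Nat.Coprime (m i) (m j)) :
    LinearIndependent ℚ (fun i : Fin n => Real.sqrt (m i)) := by
  have hpos (i : Fin n) : m i ≠ 0 := by have := hgt i; omega
  have hsqrt (i : Fin n) : ((√(m i : ℝ) : ℝ) : ℂ) ^ 2 = m i := by
    rw [← Complex.ofReal_pow, Real.sq_sqrt (Nat.cast_nonneg _), Complex.ofReal_natCast]
  have hmem (i : Fin n) : ((√(m i : ℝ) : ℝ) : ℂ) ∈ algebraicClosure ℚ ℂ := by
    rw [mem_algebraicClosure_iff]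
    refine IsAlgebraic.of_pow two_pos ?_
    rw [hsqrt i]
    exact isAlgebraic_natCast (m i)
  let x (i : Fin n) : algebraicClosure ℚ ℂ := ⟨_, hmem i⟩
  have : IsAlgClosure ℚ (algebraicClosure ℚ ℂ) :=
    algebraicClosure.isAlgClosure ℚ ℂ
  have : IsGalois ℚ (algebraicClosure ℚ ℂ) := IsAlgClosure.isGalois ℚ _
  have hx : LinearIndependent ℚ x := by
    refine linearIndependent_of_sq_mem_bot x (fun i h => ?_) (fun i => ?_) fun i j hij h => ?_
    · have := congrArg Subtype.val h
      simp [x, hpos i] at this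
    · refine IntermediateField.mem_bot.2 ⟨m i, Subtype.ext ?_⟩
      simpa [x] using (hsqrt i).symm
    · obtain ⟨q, hq⟩ := IntermediateField.mem_bot.1 h
      refine irrational_sqrt_div_sqrt (hsf i) (hgt i) (hpos j) (hcop i j hij) ⟨q, ?_⟩
      have := congrArg Subtype.val hq
      simp [x] at this
      exact_mod_cast this
  have hC := hx.map' (algebraicClosure ℚ ℂ).val.toLinearMap
    (LinearMap.ker_eq_bot.2 (algebraicClosure ℚ ℂ).val.injective)
  exact LinearIndependent.of_comp (Complex.ofRealAm.restrictScalars ℚ).toLinearMap hC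
end

section
/- Let m₁, m₂, …, m_n be pairwise coprime squarefree integers, each greater than 1. Then the degree of the field extension ℚ(√m₁, √m₂, …, √m_n) over ℚ equals 2ⁿ. -/
open IntermediateField Polynomial in
theorem IntermediateField.exists_add_mul_of_mem_adjoin_simple_sqrt {K E : Type*} [Field K] [Field E]
    [Algebra K E] {x y : E} {a : K} (hx : x ^ 2 = algebraMap K E a) (hy : y ∈ K⟮x⟯) :
    ∃ u v : K, y = algebraMap K E u + algebraMap K E v * x := by
  have hint : IsIntegral K x := ⟨X ^ 2 - C a, monic_X_pow_sub_C a two_ne_zero, by simp [hx]⟩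
  rw [← mem_toSubalgebra, adjoin_simple_toSubalgebra_of_isAlgebraic hint.isAlgebraic] at hy
  induction hy using Algebra.adjoin_induction with
  | mem z hz => exact ⟨0, 1, by simpa using hz⟩
  | algebraMap r => exact ⟨r, 0, by simp⟩
  | add z w _ _ hz hw =>
    obtain ⟨u, v, rfl⟩ := hz
    obtain ⟨u', v', rfl⟩ := hw
    exact ⟨u + u', v + v', by simp only [map_add]; ring⟩
  | mul z w _ _ hz hw =>
    obtain ⟨u, v, rfl⟩ := hz
    obtain ⟨u', v', rfl⟩ := hw
    refine ⟨u * u' + v * v' * a, u * v' + v * u', ?_⟩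
    simp only [map_add, map_mul, ← hx]
    ring

open IntermediateField in
theorem IntermediateField.mem_or_mul_mem_of_mem_adjoin_simple_sqrt {K E : Type*} [Field K] [Field E]
    [Algebra K E] [NeZero (2 : E)] {x y : E}
    (hx : x ^ 2 ∈ (algebraMap K E).range) (hy2 : y ^ 2 ∈ (algebraMap K E).range)
    (hy : y ∈ K⟮x⟯) :
    y ∈ (algebraMap K E).range ∨ x * y ∈ (algebraMap K E).range := by
  obtain ⟨a, ha⟩ := hx
  obtain ⟨b, hb⟩ := hy2
  obtain ⟨u, v, rfl⟩ := exists_add_mul_of_mem_adjoin_simple_sqrt ha.symm hy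
  by_cases hv : v = 0
  · exact .inl ⟨u, by simp [hv]⟩
  by_cases hu : u = 0
  · exact .inr ⟨v * a, by simp only [hu, map_mul, map_zero, ha]; ring⟩
  have hu' : algebraMap K E u ≠ 0 := by simpa using hu
  have hv' : algebraMap K E v ≠ 0 := by simpa using hv
  have h2 : (2 : E) ≠ 0 := two_ne_zero
  have hxK : x = algebraMap K E ((b - u ^ 2 - v ^ 2 * a) / (2 * u * v)) := by
    simp only [map_div₀, map_sub, map_mul, map_pow, map_ofNat, ha, hb]
    field_simp
    ring
  exact .inl ⟨u + v * ((b - u ^ 2 - v ^ 2 * a) / (2 * u * v)), by rw [map_add, map_mul, ← hxK]⟩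

open IntermediateField in
theorem IntermediateField.restrictScalars_adjoin_image_insert (F : Type*) {E ι : Type*} [Field F]
    [Field E] [Algebra F E] [DecidableEq ι] (x : ι → E) (j : ι) (S : Finset ι) :
    (adjoin (adjoin F (x '' S)) {x j}).restrictScalars F =
      adjoin F (x '' (insert j S : Finset ι)) := by
  rw [adjoin_adjoin_left, Finset.coe_insert, Set.image_insert_eq, Set.union_singleton]

/-- A square root contained in a multiquadratic extension becomes rational after multiplication
by some product of the generating square roots. -/
theorem IntermediateField.exists_mul_prod_mem_of_mem_adjoin_sqrt {F E ι : Type*} [Field F]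
    [Field E] [Algebra F E] [NeZero (2 : E)] [DecidableEq ι] {x : ι → E}
    (hx : ∀ i, x i ^ 2 ∈ (algebraMap F E).range) (S : Finset ι) {y : E}
    (hy2 : y ^ 2 ∈ (algebraMap F E).range) (hy : y ∈ adjoin F (x '' S)) :
    ∃ T ⊆ S, y * ∏ i ∈ T, x i ∈ (algebraMap F E).range := by
  induction S using Finset.induction_on generalizing y with
  | empty =>
    refine ⟨∅, subset_rfl, ?_⟩
    simpa [mem_bot] using hy
  | insert j S hj ih =>
    rw [← restrictScalars_adjoin_image_insert, mem_restrictScalars] at hy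
    have up {z : E} (hz : z ∈ (algebraMap F E).range) :
        z ∈ (algebraMap (adjoin F (x '' (S : Set ι))) E).range := by
      obtain ⟨c, rfl⟩ := hz
      exact ⟨algebraMap F _ c, rfl⟩
    have down {z : E} (hz : z ∈ (algebraMap (adjoin F (x '' (S : Set ι))) E).range) :
        z ∈ adjoin F (x '' (S : Set ι)) := by
      obtain ⟨c, rfl⟩ := hz
      exact c.2
    rcases mem_or_mul_mem_of_mem_adjoin_simple_sqrt (up (hx j)) (up hy2) hy with h | h
    · obtain ⟨T, hT, hTy⟩ := ih hy2 (down h)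
      exact ⟨T, hT.trans (Finset.subset_insert j S), hTy⟩
    · obtain ⟨T, hT, hTy⟩ := ih (by rw [mul_pow]; exact mul_mem (hx j) hy2) (down h)
      refine ⟨insert j T, Finset.insert_subset_insert j hT, ?_⟩
      rw [Finset.prod_insert fun h => hj (hT h)]
      convert hTy using 1
      ring

open IntermediateField Polynomial in
theorem IntermediateField.finrank_adjoin_simple_sqrt {K E : Type*} [Field K] [Field E]
    [Algebra K E] {x : E} (hx : x ^ 2 ∈ (algebraMap K E).range)
    (hxK : x ∉ (algebraMap K E).range) : Module.finrank K K⟮x⟯ = 2 := by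
  obtain ⟨a, ha⟩ := hx
  have hmonic : (X ^ 2 - C a).Monic := monic_X_pow_sub_C a two_ne_zero
  have hroot : aeval x (X ^ 2 - C a) = 0 := by simp [ha]
  have hirr : Irreducible (X ^ 2 - C a) := by
    refine X_pow_sub_C_irreducible_of_prime Nat.prime_two fun b hb => hxK ?_
    have hsq : x ^ 2 = algebraMap K E b ^ 2 := by rw [← ha, ← hb, map_pow]
    rcases sq_eq_sq_iff_eq_or_eq_neg.mp hsq with h | h
    · exact ⟨b, h.symm⟩
    · exact ⟨-b, by rw [h, map_neg]⟩
  rw [adjoin.finrank ⟨_, hmonic, hroot⟩, ← minpoly.eq_of_irreducible_of_monic hirr hroot hmonic,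
    natDegree_X_pow_sub_C]

/-- If no nonempty subproduct of the square roots `x i` is rational, then adjoining them yields an
extension of the maximal possible degree. -/
theorem IntermediateField.finrank_adjoin_image_sqrt {F E ι : Type*} [Field F]
    [Field E] [Algebra F E] [NeZero (2 : E)] [DecidableEq ι] {x : ι → E}
    (hx : ∀ i, x i ^ 2 ∈ (algebraMap F E).range)
    (hprod : ∀ T : Finset ι, T.Nonempty → ∏ i ∈ T, x i ∉ (algebraMap F E).range)
    (S : Finset ι) : Module.finrank F (adjoin F (x '' S)) = 2 ^ S.card := by
  induction S using Finset.induction_on with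
  | empty => simp
  | insert j S hj ih =>
    rw [← restrictScalars_adjoin_image_insert, Finset.card_insert_of_notMem hj, pow_succ, ← ih]
    have hsq : x j ^ 2 ∈ (algebraMap (adjoin F (x '' (S : Set ι))) E).range := by
      obtain ⟨c, hc⟩ := hx j
      exact ⟨algebraMap F _ c, hc⟩
    have hnot : x j ∉ (algebraMap (adjoin F (x '' (S : Set ι))) E).range := by
      rintro ⟨c, hc⟩
      obtain ⟨T, hT, h⟩ := exists_mul_prod_mem_of_mem_adjoin_sqrt hx S (hx j) (hc ▸ c.2)
      rw [← Finset.prod_insert fun h => hj (hT h)] at h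
      exact hprod _ (Finset.insert_nonempty j T) h
    rw [← finrank_adjoin_simple_sqrt hsq hnot]
    exact (Module.finrank_mul_finrank F (adjoin F (x '' (S : Set ι)))
      (adjoin (adjoin F (x '' (S : Set ι))) {x j})).symm

theorem Nat.not_isSquare_of_squarefree {k : ℕ} (hk : Squarefree k) (hk1 : k ≠ 1) :
    ¬IsSquare k := by
  rintro ⟨r, rfl⟩
  have hr : r = 1 := Nat.isUnit_iff.mp (hk r dvd_rfl)
  exact hk1 (by rw [hr])

theorem Nat.not_isSquare_prod_of_pairwise_coprime {ι : Type*} {m : ι → ℕ}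
    (hsf : ∀ i, Squarefree (m i)) (hne : ∀ i, m i ≠ 1)
    (hcop : ∀ i j, i ≠ j → Nat.Coprime (m i) (m j)) {T : Finset ι} (hT : T.Nonempty) :
    ¬IsSquare (∏ i ∈ T, m i) := by
  refine not_isSquare_of_squarefree ?_ ?_
  · exact Finset.squarefree_prod_of_pairwise_isCoprime
      (fun i _ j _ hij => Nat.coprime_iff_isRelPrime.mp (hcop i j hij)) fun i _ => hsf i
  · obtain ⟨i, hi⟩ := hT
    exact fun h => hne i (Nat.dvd_one.mp (h ▸ Finset.dvd_prod_of_mem m hi))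


/-- Let `m₁, …, m_n` be pairwise coprime squarefree integers, each
greater than `1`. Then `[ℚ(√m₁, …, √m_n) : ℚ] = 2 ^ n`. -/
theorem finrank_adjoin_sqrt
    (n : ℕ) (m : Fin n → ℕ)
    (hsf : ∀ i, Squarefree (m i))
    (hgt : ∀ i, 1 < m i)
    (hcop : ∀ i j, i ≠ j → Nat.Coprime (m i) (m j)) :
    Module.finrank ℚ
      (IntermediateField.adjoin ℚ (Set.range fun i : Fin n => Real.sqrt (m i))) = 2 ^ n := by
  have hsq (i : Fin n) : Real.sqrt (m i) ^ 2 ∈ (algebraMap ℚ ℝ).range :=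
    ⟨m i, by simp⟩
  have hprod (T : Finset (Fin n)) (hT : T.Nonempty) :
      ∏ i ∈ T, Real.sqrt (m i) ∉ (algebraMap ℚ ℝ).range := by
    rintro ⟨q, hq⟩
    refine Nat.not_isSquare_prod_of_pairwise_coprime hsf (fun i => (hgt i).ne') hcop hT ?_
    rw [← Rat.isSquare_natCast_iff]
    refine ⟨q, (algebraMap ℚ ℝ).injective ?_⟩
    rw [map_mul, hq, ← Finset.prod_mul_distrib]
    simp
  have h := IntermediateField.finrank_adjoin_image_sqrt hsq hprod Finset.univ
  rwa [Finset.coe_univ, Set.image_univ, Finset.card_univ, Fintype.card_fin] at h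
end

section
/- Let m₁, m₂, …, m_{k+1} be pairwise coprime squarefree integers, each greater than 1. Then √m_{k+1} does not belong to the field ℚ(√m₁, √m₂, …, √m_k). -/
open IntermediateField in
/-- Every element of a simple extension generated by a square root is of the form `u + v * a`. -/
theorem exists_eq_add_mul_of_mem_adjoin_of_sq_mem {F E : Type*} [Field F] [Field E] [Algebra F E]
    {K : IntermediateField F E} {a y : E} (ha : a ^ 2 ∈ K) (hy : y ∈ adjoin K {a}) :
    ∃ u ∈ K, ∃ v ∈ K, y = u + v * a := by
  have hint : IsIntegral K a :=
    IsIntegral.of_pow two_pos (isIntegral_algebraMap (x := (⟨a ^ 2, ha⟩ : K)))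
  replace hy : y ∈ Algebra.adjoin K {a} := by
    rwa [← adjoin_simple_toSubalgebra_of_isAlgebraic hint.isAlgebraic, mem_toSubalgebra]
  induction hy using Algebra.adjoin_induction with
  | mem x hx => exact ⟨0, K.zero_mem, 1, K.one_mem, by simpa using hx⟩
  | algebraMap r => exact ⟨r, r.2, 0, K.zero_mem, by simp [IntermediateField.algebraMap_apply]⟩
  | add x y _ _ ihx ihy =>
    obtain ⟨u, hu, v, hv, rfl⟩ := ihx
    obtain ⟨u', hu', v', hv', rfl⟩ := ihy
    exact ⟨u + u', K.add_mem hu hu', v + v', K.add_mem hv hv', by ring⟩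
  | mul x y _ _ ihx ihy =>
    obtain ⟨u, hu, v, hv, rfl⟩ := ihx
    obtain ⟨u', hu', v', hv', rfl⟩ := ihy
    exact ⟨u * u' + v * v' * a ^ 2,
      K.add_mem (K.mul_mem hu hu') (K.mul_mem (K.mul_mem hv hv') ha),
      u * v' + v * u', K.add_mem (K.mul_mem hu hv') (K.mul_mem hv hu'), by ring⟩

open IntermediateField in
/-- If `y` and all `x i` are square roots of elements of `F` and `y ∈ F(x i : i ∈ s)`, then
`y` times a product of some of the `x i` lies in `F`. -/
theorem exists_mul_prod_mem_bot_of_mem_adjoin {F E ι : Type*} [Field F] [Field E] [Algebra F E]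
    [NeZero (2 : E)] (x : ι → E) (hx : ∀ i, x i ^ 2 ∈ (⊥ : IntermediateField F E))
    (s : Finset ι) (y : E) (hy : y ^ 2 ∈ (⊥ : IntermediateField F E))
    (hys : y ∈ adjoin F (x '' s)) :
    ∃ t ⊆ s, y * ∏ i ∈ t, x i ∈ (⊥ : IntermediateField F E) := by
  classical
  induction s using Finset.induction_on generalizing y with
  | empty => exact ⟨∅, subset_rfl, by simpa using hys⟩
  | insert j s hj ih =>
    set K := adjoin F (x '' s)
    have mem_of_mem_bot : ∀ z ∈ (⊥ : IntermediateField F E), z ∈ K := fun z hz ↦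
      (bot_le : ⊥ ≤ K) hz
    have of_mem : y ∈ K → ∃ t ⊆ insert j s, y * ∏ i ∈ t, x i ∈ (⊥ : IntermediateField F E) := by
      intro h
      obtain ⟨t, ht, h⟩ := ih y hy h
      exact ⟨t, ht.trans (Finset.subset_insert j s), h⟩
    have hyK : y ∈ adjoin K {x j} := by
      rw [← mem_restrictScalars (K := F), adjoin_adjoin_left, Set.union_singleton,
        ← Set.image_insert_eq, ← Finset.coe_insert]
      exact hys
    obtain ⟨u, hu, v, hv, rfl⟩ :=
      exists_eq_add_mul_of_mem_adjoin_of_sq_mem (mem_of_mem_bot _ (hx j)) hyK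
    by_cases hu0 : u = 0
    · subst hu0
      obtain ⟨t, ht, h⟩ := ih ((0 + v * x j) * x j)
        (by rw [mul_pow]; exact mul_mem hy (hx j))
        (by
          rw [show (0 + v * x j) * x j = v * x j ^ 2 by ring]
          exact K.mul_mem hv (mem_of_mem_bot _ (hx j)))
      refine ⟨insert j t, Finset.insert_subset_insert j ht, ?_⟩
      rwa [Finset.prod_insert fun hjt ↦ hj (ht hjt), ← mul_assoc]
    by_cases hv0 : v = 0
    · exact of_mem (by simpa [hv0] using hu)
    refine of_mem (K.add_mem hu (K.mul_mem hv ?_))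
    have two_mem : (2 : E) ∈ K := ofNat_mem K 2
    have key : x j = ((u + v * x j) ^ 2 - u ^ 2 - v ^ 2 * x j ^ 2) / (2 * u * v) := by
      have := NeZero.ne (2 : E)
      field_simp
      ring
    rw [key]
    exact K.div_mem (K.sub_mem (K.sub_mem (mem_of_mem_bot _ hy) (_root_.pow_mem hu 2))
      (K.mul_mem (_root_.pow_mem hv 2) (mem_of_mem_bot _ (hx j)))) (K.mul_mem (K.mul_mem two_mem hu) hv)

/-- Let `m₁, …, m_{k+1}` be pairwise coprime squarefree integers, each
greater than `1`. Then `√m_{k+1} ∉ ℚ(√m₁, …, √m_k)`. -/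
theorem sqrt_not_mem_adjoin
    (k : ℕ) (m : Fin (k + 1) → ℕ)
    (hsf : ∀ i, Squarefree (m i))
    (hgt : ∀ i, 1 < m i)
    (hcop : ∀ i j, i ≠ j → Nat.Coprime (m i) (m j)) :
    Real.sqrt (m (Fin.last k)) ∉
      IntermediateField.adjoin ℚ (Set.range fun i : Fin k => Real.sqrt (m i.castSucc)) := by
  intro hmem
  have sq_mem (n : ℕ) : Real.sqrt n ^ 2 ∈ (⊥ : IntermediateField ℚ ℝ) := by
    rw [Real.sq_sqrt n.cast_nonneg]
    exact natCast_mem _ n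
  obtain ⟨t, -, ht⟩ := exists_mul_prod_mem_bot_of_mem_adjoin (F := ℚ)
    (fun i : Fin k ↦ Real.sqrt (m i.castSucc)) (fun _ ↦ sq_mem _) Finset.univ _ (sq_mem _)
    (by simpa using hmem)
  have hcop' : (m (Fin.last k)).Coprime (∏ i ∈ t, m i.castSucc) :=
    Nat.Coprime.prod_right fun i _ ↦ hcop _ _ (Fin.castSucc_ne_last i).symm
  have hsf' : Squarefree (m (Fin.last k) * ∏ i ∈ t, m i.castSucc) := by
    refine (Nat.squarefree_mul hcop').2 ⟨hsf _, ?_⟩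
    refine Finset.squarefree_prod_of_pairwise_isCoprime (fun i _ j _ hij ↦ ?_) fun i _ ↦ hsf _
    exact Nat.coprime_iff_isRelPrime.1 (hcop _ _ ((Fin.castSucc_injective k).ne hij))
  have hnsq : ¬ IsSquare (m (Fin.last k) * ∏ i ∈ t, m i.castSucc) := by
    rintro ⟨r, hr⟩
    have hr1 : r = 1 := Nat.isUnit_iff.1 (hsf' r hr.symm.dvd)
    rw [hr1, mul_one] at hr
    exact (hgt (Fin.last k)).ne' (Nat.eq_one_of_mul_eq_one_right hr)
  refine irrational_sqrt_natCast_iff.2 hnsq ?_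
  rw [Nat.cast_mul, Nat.cast_prod, Real.sqrt_mul (Nat.cast_nonneg _),
    Real.sqrt_prod _ fun _ _ ↦ Nat.cast_nonneg _]
  obtain ⟨q, hq⟩ := IntermediateField.mem_bot.1 ht
  exact ⟨q, by simpa using hq⟩
end

section
/- Let w = w₁w₂⋯w_n be a word over the alphabet {a, b, a⁻¹, b⁻¹} and write q_w = r + x𝐢 + y𝐣 + z𝐤 with r, x, y, z ∈ ℝ. Then for the reversed word w^R = w_n⋯w₂w₁ one has q_{w^R} = r + x𝐢 + y𝐣 − z𝐤. -/
open Quaternion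

/-- The four-letter alphabet `{a, b, a⁻¹, b⁻¹}`. -/
inductive Letter : Type
  | a : Letter
  | b : Letter
  | ainv : Letter
  | binv : Letter

/-- The quaternion associated to each letter: `q_a = (3+4𝐢)/5`, `q_b = (3+4𝐣)/5`,
`q_{a⁻¹} = (3−4𝐢)/5`, `q_{b⁻¹} = (3−4𝐣)/5`. -/
noncomputable def qLetter : Letter → ℍ[ℝ]
  | .a => ⟨3/5, 4/5, 0, 0⟩
  | .b => ⟨3/5, 0, 4/5, 0⟩
  | .ainv => ⟨3/5, -4/5, 0, 0⟩
  | .binv => ⟨3/5, 0, -4/5, 0⟩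

/-- For a word `w = w₁w₂⋯w_n`, the ordered product `q_w = q_{w₁}q_{w₂}⋯q_{w_n}`
(with `q_ε = 1`). -/
noncomputable def qWord (w : List Letter) : ℍ[ℝ] :=
  (w.map qLetter).prod

/-- The map `r + x𝐢 + y𝐣 + z𝐤 ↦ r + x𝐢 + y𝐣 − z𝐤`. -/
def negImK (q : ℍ[ℝ]) : ℍ[ℝ] :=
  ⟨q.re, q.imI, q.imJ, -q.imK⟩

@[simp] theorem re_negImK (q : ℍ[ℝ]) : (negImK q).re = q.re := rfl

@[simp] theorem imI_negImK (q : ℍ[ℝ]) : (negImK q).imI = q.imI := rfl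

@[simp] theorem imJ_negImK (q : ℍ[ℝ]) : (negImK q).imJ = q.imJ := rfl

@[simp] theorem imK_negImK (q : ℍ[ℝ]) : (negImK q).imK = -q.imK := rfl

theorem negImK_one : negImK 1 = 1 := by
  ext <;> simp

/-- `negImK` reverses products. -/
theorem negImK_mul (p q : ℍ[ℝ]) : negImK (p * q) = negImK q * negImK p := by
  ext <;> simp <;> ring

theorem imK_qLetter (l : Letter) : (qLetter l).imK = 0 := by
  cases l <;> rfl

theorem negImK_qLetter (l : Letter) : negImK (qLetter l) = qLetter l := by
  ext <;> simp [imK_qLetter]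

theorem qWord_reverse_eq_negImK (w : List Letter) : qWord w.reverse = negImK (qWord w) := by
  induction w with
  | nil => simp [qWord, negImK_one]
  | cons l w ih =>
    have hcons : qWord (l :: w) = qLetter l * qWord w := by simp [qWord]
    have hsnoc : qWord (l :: w).reverse = qWord w.reverse * qLetter l := by simp [qWord]
    rw [hcons, hsnoc, ih, negImK_mul, negImK_qLetter]

/-- If `q_w = r + x𝐢 + y𝐣 + z𝐤`, then for the reversed word `w^R`
one has `q_{w^R} = r + x𝐢 + y𝐣 − z𝐤`. -/
theorem qWord_reverse (w : List Letter) (r x y z : ℝ)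
    (h : qWord w = ⟨r, x, y, z⟩) :
    qWord w.reverse = ⟨r, x, y, -z⟩ := by
  rw [qWord_reverse_eq_negImK, h]
  rfl
end

section
/- Let σ_a be the letterwise map on words over {a, b, a⁻¹, b⁻¹} that exchanges a ↔ a⁻¹ and fixes b and b⁻¹ (preserving the order of letters). If w is a word over {a, b, a⁻¹, b⁻¹} and q_w = r + x𝐢 + y𝐣 + z𝐤 with r, x, y, z ∈ ℝ, then q_{σ_a(w)} = r − x𝐢 + y𝐣 − z𝐤. -/
open Quaternion

/-- The letterwise map `σ_a` exchanging `a ↔ a⁻¹` and fixing `b`, `b⁻¹`. -/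
def sigmaA : Letter → Letter
  | .a => .ainv
  | .ainv => .a
  | .b => .b
  | .binv => .binv

/-- The map `r + x𝐢 + y𝐣 + z𝐤 ↦ r − x𝐢 + y𝐣 − z𝐤`. -/
def negIK (q : ℍ[ℝ]) : ℍ[ℝ] := ⟨q.re, -q.imI, q.imJ, -q.imK⟩

@[simp] theorem re_negIK (q : ℍ[ℝ]) : (negIK q).re = q.re := rfl

@[simp] theorem imI_negIK (q : ℍ[ℝ]) : (negIK q).imI = -q.imI := rfl

@[simp] theorem imJ_negIK (q : ℍ[ℝ]) : (negIK q).imJ = q.imJ := rfl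

@[simp] theorem imK_negIK (q : ℍ[ℝ]) : (negIK q).imK = -q.imK := rfl

theorem negIK_one : negIK 1 = 1 := by
  ext <;> simp

theorem negIK_mul (p q : ℍ[ℝ]) : negIK (p * q) = negIK p * negIK q := by
  ext <;> simp <;> ring

theorem qLetter_sigmaA (l : Letter) : qLetter (sigmaA l) = negIK (qLetter l) := by
  ext <;> simp only [re_negIK, imI_negIK, imJ_negIK, imK_negIK] <;>
    cases l <;> simp [sigmaA, qLetter, neg_div]

theorem qWord_map_sigmaA (w : List Letter) : qWord (w.map sigmaA) = negIK (qWord w) := by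
  induction w with
  | nil => exact negIK_one.symm
  | cons l w ih =>
    simp only [qWord, List.map_cons, List.prod_cons] at ih ⊢
    rw [ih, qLetter_sigmaA, negIK_mul]

/-- If `q_w = r + x𝐢 + y𝐣 + z𝐤`, then
`q_{σ_a(w)} = r − x𝐢 + y𝐣 − z𝐤`. -/
theorem qWord_sigmaA (w : List Letter) (r x y z : ℝ)
    (h : qWord w = ⟨r, x, y, z⟩) :
    qWord (w.map sigmaA) = ⟨r, -x, y, -z⟩ := by
  rw [qWord_map_sigmaA, h]
  rfl
end

section
/- Let σ_{a,b} be the letterwise map on words over {a, b, a⁻¹, b⁻¹} that exchanges a ↔ a⁻¹ and b ↔ b⁻¹ (preserving the order of letters). If w is a word over {a, b, a⁻¹, b⁻¹} and q_w = r + x𝐢 + y𝐣 + z𝐤 with r, x, y, z ∈ ℝ, then q_{σ_{a,b}(w)} = r − x𝐢 − y𝐣 + z𝐤. -/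
open Quaternion

/-- The letterwise map `σ_{a,b}` exchanging `a ↔ a⁻¹` and `b ↔ b⁻¹`. -/
def sigmaAB : Letter → Letter
  | .a => .ainv
  | .ainv => .a
  | .b => .binv
  | .binv => .b

/-- The map negating the `𝐢` and `𝐣` components, that is, conjugation by `𝐤`. -/
def conjK (q : ℍ[ℝ]) : ℍ[ℝ] := ⟨q.re, -q.imI, -q.imJ, q.imK⟩

@[simp] theorem re_conjK (q : ℍ[ℝ]) : (conjK q).re = q.re := rfl

@[simp] theorem imI_conjK (q : ℍ[ℝ]) : (conjK q).imI = -q.imI := rfl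

@[simp] theorem imJ_conjK (q : ℍ[ℝ]) : (conjK q).imJ = -q.imJ := rfl

@[simp] theorem imK_conjK (q : ℍ[ℝ]) : (conjK q).imK = q.imK := rfl

theorem conjK_one : conjK 1 = 1 := by
  ext <;> simp

theorem conjK_mul (p q : ℍ[ℝ]) : conjK (p * q) = conjK p * conjK q := by
  ext <;> simp <;> ring

theorem qLetter_sigmaAB (l : Letter) : qLetter (sigmaAB l) = conjK (qLetter l) := by
  cases l <;> simp [qLetter, sigmaAB, conjK, neg_div] <;> rfl

theorem qWord_cons (l : Letter) (w : List Letter) : qWord (l :: w) = qLetter l * qWord w := by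
  simp [qWord]

theorem qWord_map_sigmaAB (w : List Letter) : qWord (w.map sigmaAB) = conjK (qWord w) := by
  induction w with
  | nil => simp [qWord, conjK_one]
  | cons l w ih => rw [List.map_cons, qWord_cons, qWord_cons, conjK_mul, qLetter_sigmaAB, ih]

/-- If `q_w = r + x𝐢 + y𝐣 + z𝐤`, then
`q_{σ_{a,b}(w)} = r − x𝐢 − y𝐣 + z𝐤`. -/
theorem qWord_sigmaAB (w : List Letter) (r x y z : ℝ)
    (h : qWord w = ⟨r, x, y, z⟩) :
    qWord (w.map sigmaAB) = ⟨r, -x, -y, z⟩ := by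
  rw [qWord_map_sigmaAB, h]
  rfl
end

section
/- Let L and M be finite lists of positive integers and write γ(L) = r₁ + x₁𝐢 + y₁𝐣 + z₁𝐤 and γ(M) = r₂ + x₂𝐢 + y₂𝐣 + z₂𝐤 with real coefficients. If |r₁| = |r₂|, |x₁| = |x₂| and |y₁| = |y₂|, then L = M (and hence γ(L) = γ(M)). -/
open Quaternion

/-- The unit quaternion `q_a = (3 + 4𝐢)/5`. -/
noncomputable def qa : ℍ[ℝ] := ⟨3/5, 4/5, 0, 0⟩

/-- The unit quaternion `q_b = (3 + 4𝐣)/5`. -/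
noncomputable def qb : ℍ[ℝ] := ⟨3/5, 0, 4/5, 0⟩

/-- For a finite list `L = (k₁, …, k_t)` of positive integers,
`γ(L) = (q_a^{k₁} q_b)(q_a^{k₂} q_b)⋯(q_a^{k_t} q_b)`, with `γ([]) = 1`. -/
noncomputable def gamma (L : List ℕ+) : ℍ[ℝ] :=
  (L.map fun k => qa ^ (k : ℕ) * qb).prod

/-- The integral quaternion `5 q_a` (for `true`) or `5 q_b` (for `false`). -/
def intLetter (b : Bool) : ℍ[ℤ] := if b then ⟨3, 4, 0, 0⟩ else ⟨3, 0, 4, 0⟩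

@[simp] theorem re_intLetter (b : Bool) : (intLetter b).re = 3 := by cases b <;> rfl

@[simp] theorem imI_intLetter (b : Bool) : (intLetter b).imI = if b then 4 else 0 := by
  cases b <;> rfl

@[simp] theorem imJ_intLetter (b : Bool) : (intLetter b).imJ = if b then 0 else 4 := by
  cases b <;> rfl

@[simp] theorem imK_intLetter (b : Bool) : (intLetter b).imK = 0 := by cases b <;> rfl

/-- The product of the integral quaternions attached to the letters of a word. -/
def intWord (w : List Bool) : ℍ[ℤ] := (w.map intLetter).prod

/-- The word `a^{k₁} b a^{k₂} b ⋯ a^{k_t} b`, with `a = true` and `b = false`. -/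
def encode : List ℕ+ → List Bool
  | [] => []
  | k :: L => List.replicate k true ++ false :: encode L

theorem replicate_true_append_false_inj {m n : ℕ} {u v : List Bool}
    (h : List.replicate m true ++ false :: u = List.replicate n true ++ false :: v) :
    m = n ∧ u = v := by
  induction m generalizing n with
  | zero => cases n <;> simp_all [List.replicate_succ]
  | succ m ih =>
    cases n with
    | zero => simp [List.replicate_succ] at h
    | succ n =>
      simp only [List.replicate_succ, List.cons_append, List.cons.injEq, true_and] at h
      simpa using ih h

theorem encode_injective : Function.Injective encode := by
  intro L
  induction L with
  | nil => intro M h; cases M <;> simp_all [encode]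
  | cons k L ih =>
    intro M h
    cases M with
    | nil => simp [encode] at h
    | cons l M =>
      obtain ⟨hk, hLM⟩ := replicate_true_append_false_inj h
      rw [PNat.coe_injective hk, ih hLM]

theorem intWord_nil : intWord [] = 1 := rfl

theorem intWord_cons (b : Bool) (w : List Bool) :
    intWord (b :: w) = intLetter b * intWord w := by simp [intWord]

theorem intLetter_ne_zero (b : Bool) : intLetter b ≠ 0 := by
  intro h
  have := congrArg QuaternionAlgebra.re h
  simp at this

/-- A nonempty word is nonzero modulo `5` and modulo `5` lies in the right ideal generated by its
first letter. -/
theorem intWord_cons_mod_five (b : Bool) (w : List Bool) :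
    let q := intWord (b :: w)
    ((b = true ∧ (q.imI - 3 * q.re) % 5 = 0 ∧ (q.imK - 3 * q.imJ) % 5 = 0) ∨
      (b = false ∧ (q.imJ - 3 * q.re) % 5 = 0 ∧ (q.imK - 2 * q.imI) % 5 = 0)) ∧
    ¬(q.re % 5 = 0 ∧ q.imI % 5 = 0 ∧ q.imJ % 5 = 0 ∧ q.imK % 5 = 0) := by
  induction w generalizing b with
  | nil => cases b <;> simp [intWord]
  | cons c w ih =>
    have := ih c
    rw [intWord_cons b]
    generalize intWord (c :: w) = q at this
    cases b <;> cases c <;> simp at this ⊢ <;> omega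

theorem eq_of_intWord_eq_or_neg {u v : List Bool} (hlen : u.length = v.length)
    (h : intWord u = intWord v ∨ intWord u = -intWord v) : u = v := by
  induction u generalizing v with
  | nil => exact (List.length_eq_zero_iff.mp hlen.symm).symm
  | cons b u ih =>
    cases v with
    | nil => simp at hlen
    | cons c v =>
      have hb := intWord_cons_mod_five b u
      have hc := intWord_cons_mod_five c v
      have hbc : b = c := by
        rcases h with h | h <;> rw [h] at hb <;> generalize intWord (c :: v) = q at hb hc <;>
          cases b <;> cases c <;> simp at hb hc ⊢ <;> omega
      subst hbc
      rw [ih (by simpa using hlen)]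
      rw [intWord_cons, intWord_cons, ← mul_neg] at h
      exact h.imp (mul_left_cancel₀ (intLetter_ne_zero b))
        (mul_left_cancel₀ (intLetter_ne_zero b))

/-- Modulo `5`, a word ending in `b` lies in the left ideal generated by `5 q_b`. -/
theorem intWord_append_false_mod_five (w : List Bool) :
    let q := intWord (w ++ [false])
    (q.imJ - 3 * q.re) % 5 = 0 ∧ (q.imK - 3 * q.imI) % 5 = 0 := by
  induction w with
  | nil => simp [intWord]
  | cons b w ih =>
    rw [List.cons_append, intWord_cons]
    generalize intWord (w ++ [false]) = q at ih
    cases b <;> simp at ih ⊢ <;> omega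

theorem exists_encode_cons_eq_append (k : ℕ+) (L : List ℕ+) :
    ∃ w, encode (k :: L) = w ++ [false] := by
  induction L generalizing k with
  | nil => exact ⟨List.replicate k true, rfl⟩
  | cons l L ih =>
    obtain ⟨w, hw⟩ := ih l
    exact ⟨List.replicate k true ++ false :: w, by rw [encode, hw]; simp⟩

theorem exists_encode_cons_eq_cons (k : ℕ+) (L : List ℕ+) :
    ∃ w, encode (k :: L) = true :: w := by
  obtain ⟨n, hn⟩ := Nat.exists_eq_succ_of_ne_zero k.ne_zero
  exact ⟨List.replicate n true ++ false :: encode L, by simp [encode, hn, List.replicate_succ]⟩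

/-- For nonempty `L`, the integral word is a nonzero multiple of `1 + 3𝐢 + 3𝐣 - 𝐤` modulo `5`. -/
theorem intWord_encode_mod_five {L : List ℕ+} (hL : L ≠ []) :
    let q := intWord (encode L)
    q.re % 5 ≠ 0 ∧ (q.imI - 3 * q.re) % 5 = 0 ∧ (q.imJ - 3 * q.re) % 5 = 0 ∧
      (q.imK + q.re) % 5 = 0 := by
  obtain ⟨k, L, rfl⟩ := List.exists_cons_of_ne_nil hL
  obtain ⟨u, hu⟩ := exists_encode_cons_eq_append k L
  obtain ⟨v, hv⟩ := exists_encode_cons_eq_cons k L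
  have h₁ := intWord_append_false_mod_five u
  have h₂ := intWord_cons_mod_five true v
  rw [← hu] at h₁
  rw [← hv] at h₂
  generalize intWord (encode (k :: L)) = q at h₁ h₂
  simp at h₁ h₂ ⊢
  omega

theorem normSq_intWord (w : List Bool) : normSq (intWord w) = 25 ^ w.length := by
  induction w with
  | nil => simp [intWord_nil]
  | cons b w ih =>
    rw [intWord_cons, map_mul, ih, List.length_cons, pow_succ']
    cases b <;> simp [normSq_def']

/-- The unit quaternion `q_a` (for `true`) or `q_b` (for `false`). -/
noncomputable def unitLetter (b : Bool) : ℍ[ℝ] := if b then qa else qb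

@[simp] theorem re_unitLetter (b : Bool) : (unitLetter b).re = 3 / 5 := by cases b <;> rfl

@[simp] theorem imI_unitLetter (b : Bool) : (unitLetter b).imI = if b then 4 / 5 else 0 := by
  cases b <;> rfl

@[simp] theorem imJ_unitLetter (b : Bool) : (unitLetter b).imJ = if b then 0 else 4 / 5 := by
  cases b <;> rfl

@[simp] theorem imK_unitLetter (b : Bool) : (unitLetter b).imK = 0 := by cases b <;> rfl

/-- The product of the unit quaternions attached to the letters of a word. -/
noncomputable def unitWord (w : List Bool) : ℍ[ℝ] := (w.map unitLetter).prod

theorem gamma_eq_unitWord (L : List ℕ+) : gamma L = unitWord (encode L) := by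
  induction L with
  | nil => rfl
  | cons k L ih =>
    have hcons : gamma (k :: L) = qa ^ (k : ℕ) * qb * gamma L := rfl
    rw [hcons, ih]
    simp [unitWord, unitLetter, encode, mul_assoc]

theorem five_pow_mul_unitWord (w : List Bool) :
    5 ^ w.length * (unitWord w).re = (intWord w).re ∧
    5 ^ w.length * (unitWord w).imI = (intWord w).imI ∧
    5 ^ w.length * (unitWord w).imJ = (intWord w).imJ ∧
    5 ^ w.length * (unitWord w).imK = (intWord w).imK := by
  induction w with
  | nil => simp [unitWord, intWord]
  | cons b w ih =>
    obtain ⟨h₁, h₂, h₃, h₄⟩ := ih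
    have hu : unitWord (b :: w) = unitLetter b * unitWord w := by simp [unitWord]
    rw [hu, intWord_cons]
    cases b <;> simp [← h₁, ← h₂, ← h₃, ← h₄, pow_succ] <;>
      refine ⟨?_, ?_, ?_, ?_⟩ <;> ring

theorem five_pow_mul_abs_eq {m n : ℕ} {s t : ℝ} {a b : ℤ} (ha : 5 ^ m * s = a)
    (hb : 5 ^ n * t = b) (h : |s| = |t|) : 5 ^ n * |a| = 5 ^ m * |b| := by
  have : (5 : ℝ) ^ n * |(a : ℝ)| = 5 ^ m * |(b : ℝ)| := by
    rw [← ha, ← hb, abs_mul, abs_mul, h, abs_of_pos (by positivity : (0 : ℝ) < 5 ^ m),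
      abs_of_pos (by positivity : (0 : ℝ) < 5 ^ n)]
    ring
  exact_mod_cast this

theorem length_encode_le_of_abs_re_eq {L M : List ℕ+}
    (h : |(gamma L).re| = |(gamma M).re|) : (encode L).length ≤ (encode M).length := by
  by_contra! hlt
  have hL : L ≠ [] := by rintro rfl; simp [encode] at hlt
  rw [gamma_eq_unitWord, gamma_eq_unitWord] at h
  have hre := five_pow_mul_abs_eq (five_pow_mul_unitWord _).1 (five_pow_mul_unitWord _).1 h
  obtain ⟨d, hd⟩ := Nat.exists_eq_add_of_lt hlt
  rw [hd, add_assoc, pow_add, mul_assoc] at hre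
  have habs := mul_left_cancel₀ (by positivity) hre
  have hdvd : (5 : ℤ) ∣ (intWord (encode L)).re := by
    rw [← dvd_abs, habs, pow_succ']
    exact ⟨5 ^ d * |(intWord (encode M)).re|, by ring⟩
  exact (intWord_encode_mod_five hL).1 (Int.emod_eq_zero_of_dvd hdvd)

/-- If `γ(L) = r₁ + x₁𝐢 + y₁𝐣 + z₁𝐤` and `γ(M) = r₂ + x₂𝐢 + y₂𝐣 + z₂𝐤`
with `|r₁| = |r₂|`, `|x₁| = |x₂|` and `|y₁| = |y₂|`, then `L = M`
(and hence `γ(L) = γ(M)`). -/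
theorem gamma_unique_abs (L M : List ℕ+) (r₁ x₁ y₁ z₁ r₂ x₂ y₂ z₂ : ℝ)
    (hL : gamma L = ⟨r₁, x₁, y₁, z₁⟩) (hM : gamma M = ⟨r₂, x₂, y₂, z₂⟩)
    (hr : |r₁| = |r₂|) (hx : |x₁| = |x₂|) (hy : |y₁| = |y₂|) :
    L = M ∧ gamma L = gamma M := by
  suffices h : L = M from ⟨h, congrArg gamma h⟩
  replace hr : |(gamma L).re| = |(gamma M).re| := by rw [hL, hM]; exact hr
  replace hx : |(gamma L).imI| = |(gamma M).imI| := by rw [hL, hM]; exact hx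
  replace hy : |(gamma L).imJ| = |(gamma M).imJ| := by rw [hL, hM]; exact hy
  have hlen := (length_encode_le_of_abs_re_eq hr).antisymm
    (length_encode_le_of_abs_re_eq hr.symm)
  apply encode_injective
  by_cases hLn : L = []
  · subst hLn
    exact (List.length_eq_zero_iff.mp hlen.symm).symm
  have hMn : M ≠ [] := by
    rintro rfl
    exact hLn (encode_injective (List.length_eq_zero_iff.mp hlen))
  apply eq_of_intWord_eq_or_neg hlen
  rw [gamma_eq_unitWord, gamma_eq_unitWord] at hr hx hy
  obtain ⟨hLr, hLx, hLy, -⟩ := five_pow_mul_unitWord (encode L)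
  obtain ⟨hMr, hMx, hMy, -⟩ := five_pow_mul_unitWord (encode M)
  have hpow : (5 : ℤ) ^ (encode M).length ≠ 0 := by positivity
  replace hr := five_pow_mul_abs_eq hLr hMr hr
  replace hx := five_pow_mul_abs_eq hLx hMx hx
  replace hy := five_pow_mul_abs_eq hLy hMy hy
  rw [hlen] at hr hx hy
  replace hr := abs_eq_abs.mp (mul_left_cancel₀ hpow hr)
  replace hx := abs_eq_abs.mp (mul_left_cancel₀ hpow hx)
  replace hy := abs_eq_abs.mp (mul_left_cancel₀ hpow hy)
  have hnorm : normSq (intWord (encode L)) = normSq (intWord (encode M)) := by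
    rw [normSq_intWord, normSq_intWord, hlen]
  rw [normSq_def', normSq_def', sq_eq_sq_iff_eq_or_eq_neg.mpr hr,
    sq_eq_sq_iff_eq_or_eq_neg.mpr hx, sq_eq_sq_iff_eq_or_eq_neg.mpr hy] at hnorm
  have hz := sq_eq_sq_iff_eq_or_eq_neg.mp (add_left_cancel hnorm)
  have hLmod := intWord_encode_mod_five hLn
  have hMmod := intWord_encode_mod_five hMn
  simp only [Quaternion.ext_iff, re_neg, imI_neg, imJ_neg, imK_neg]
  omega
end

section
/- The function f : Λ × Λ → ℚ defined by f(x, y) = (x⁴ + y⁴)³ + x⁴ is injective on Λ × Λ; that is, if x, y, x', y' ∈ Λ and (x⁴ + y⁴)³ + x⁴ = (x'⁴ + y'⁴)³ + x'⁴, then x = x' and y = y'. -/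
/-- `Λ = { a/5^k : a, k ∈ ℕ, a < 5^k }`, the set of rationals in `[0,1)` whose
denominator is a power of `5`. -/
def Lambda : Set ℚ := {q | ∃ a k : ℕ, a < 5 ^ k ∧ q = (a : ℚ) / 5 ^ k}

/-- Modulo `5`, equal cubes of sums of two fourth powers force
`M² + M N + N²` to be a unit unless all the variables vanish. -/
theorem ZMod.five_eq_zero_of_cube_sum_fourth_powers_eq :
    ∀ a b c d : ZMod 5, (a ^ 4 + b ^ 4) ^ 3 = (c ^ 4 + d ^ 4) ^ 3 →
      (a ^ 4 + b ^ 4) ^ 2 + (a ^ 4 + b ^ 4) * (c ^ 4 + d ^ 4) + (c ^ 4 + d ^ 4) ^ 2 = 0 →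
      a = 0 ∧ b = 0 ∧ c = 0 ∧ d = 0 := by
  have fourth : ∀ a : ZMod 5, a ^ 4 = 0 ∧ a = 0 ∨ a ^ 4 = 1 := by decide
  intro a b c d h₁ h₂
  rcases fourth a with ⟨ha, ha'⟩ | ha <;> rcases fourth b with ⟨hb, hb'⟩ | hb <;>
    rcases fourth c with ⟨hc, hc'⟩ | hc <;> rcases fourth d with ⟨hd, hd'⟩ | hd <;>
    rw [ha, hb, hc, hd] at h₁ h₂ <;>
    first
    | exact ⟨ha', hb', hc', hd'⟩
    | exact absurd h₁ (by decide)
    | exact absurd h₂ (by decide)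

/-- If `5 ^ (8 * k)` divides the difference of the cubes of two sums of fourth powers of numbers
below `5 ^ k`, not all divisible by `5`, then the two sums are equal. -/
theorem sum_fourth_powers_eq_of_dvd {k a b c d : ℕ} (hk : k ≠ 0)
    (ha : a < 5 ^ k) (hb : b < 5 ^ k) (hc : c < 5 ^ k) (hd : d < 5 ^ k)
    (h5 : ¬(5 ∣ a ∧ 5 ∣ b ∧ 5 ∣ c ∧ 5 ∣ d))
    (h : (5 : ℤ) ^ (8 * k) ∣ ((a : ℤ) ^ 4 + b ^ 4) ^ 3 - ((c : ℤ) ^ 4 + d ^ 4) ^ 3) :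
    a ^ 4 + b ^ 4 = c ^ 4 + d ^ 4 := by
  set M : ℤ := (a : ℤ) ^ 4 + b ^ 4 with hM
  set N : ℤ := (c : ℤ) ^ 4 + d ^ 4 with hN
  have not_dvd : ¬(5 : ℤ) ∣ M ^ 2 + M * N + N ^ 2 := by
    intro h₂
    have h₁ : (5 : ℤ) ∣ M ^ 3 - N ^ 3 := (dvd_pow_self 5 (by omega)).trans h
    have h₁' := (ZMod.intCast_zmod_eq_zero_iff_dvd _ 5).2 h₁
    have h₂' := (ZMod.intCast_zmod_eq_zero_iff_dvd _ 5).2 h₂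
    rw [hM, hN] at h₁' h₂'
    push_cast at h₁' h₂'
    have := ZMod.five_eq_zero_of_cube_sum_fourth_powers_eq a b c d (sub_eq_zero.1 h₁') h₂'
    simp only [ZMod.natCast_eq_zero_iff] at this
    exact h5 this
  have coprime : IsCoprime ((5 : ℤ) ^ (8 * k)) (M ^ 2 + M * N + N ^ 2) :=
    ((Int.prime_iff_natAbs_prime.2 (by norm_num)).coprime_iff_not_dvd.2 not_dvd).pow_left
  have dvd : (5 : ℤ) ^ (8 * k) ∣ M - N := by
    refine coprime.dvd_of_dvd_mul_right ?_
    rwa [show (M - N) * (M ^ 2 + M * N + N ^ 2) = M ^ 3 - N ^ 3 by ring]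
  have lt_pow {n : ℕ} (hn : n < 5 ^ k) : (n : ℤ) ^ 4 < 5 ^ (4 * k) := by
    rw [mul_comm, pow_mul]
    exact_mod_cast Nat.pow_lt_pow_left hn (by norm_num)
  have small : (2 : ℤ) * 5 ^ (4 * k) ≤ 5 ^ (8 * k) := by
    have : (2 : ℤ) ≤ 5 ^ (4 * k) :=
      le_trans (by norm_num) (le_self_pow₀ (a := (5 : ℤ)) (by norm_num) (by omega : 4 * k ≠ 0))
    rw [show 8 * k = 4 * k + 4 * k by ring, pow_add]
    gcongr
  have hM₀ : 0 ≤ M := by positivity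
  have hN₀ : 0 ≤ N := by positivity
  have abs_lt : |M - N| < 5 ^ (8 * k) := by
    have := lt_pow ha
    have := lt_pow hb
    have := lt_pow hc
    have := lt_pow hd
    rw [_root_.abs_lt]
    constructor <;> linarith
  have : M = N := sub_eq_zero.1 (Int.eq_zero_of_abs_lt_dvd dvd abs_lt)
  rw [hM, hN] at this
  exact_mod_cast this

/-- Injectivity of `f` on fractions with the common denominator `5 ^ k`, cleared of denominators. -/
theorem eq_of_cleared_equation (k : ℕ) : ∀ {a b c d : ℕ},
    a < 5 ^ k → b < 5 ^ k → c < 5 ^ k → d < 5 ^ k →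
    (a ^ 4 + b ^ 4) ^ 3 + 5 ^ (8 * k) * a ^ 4 = (c ^ 4 + d ^ 4) ^ 3 + 5 ^ (8 * k) * c ^ 4 →
    a = c ∧ b = d := by
  induction k with
  | zero =>
    intro a b c d ha hb hc hd _
    simp only [pow_zero] at ha hb hc hd
    omega
  | succ k ih =>
    intro a b c d ha hb hc hd h
    by_cases h5 : 5 ∣ a ∧ 5 ∣ b ∧ 5 ∣ c ∧ 5 ∣ d
    · obtain ⟨⟨a, rfl⟩, ⟨b, rfl⟩, ⟨c, rfl⟩, ⟨d, rfl⟩⟩ := h5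
      rw [pow_succ] at ha hb hc hd
      have := @ih a b c d (by omega) (by omega) (by omega) (by omega) <|
        Nat.eq_of_mul_eq_mul_left (show 0 < 5 ^ 12 by norm_num) <| by
          rw [show 8 * (k + 1) = 8 * k + 8 by ring, pow_add] at h
          linear_combination h
      omega
    · have sum_eq : a ^ 4 + b ^ 4 = c ^ 4 + d ^ 4 := by
        refine sum_fourth_powers_eq_of_dvd (k := k + 1) k.succ_ne_zero ha hb hc hd h5
          ⟨(c : ℤ) ^ 4 - a ^ 4, ?_⟩
        zify at h
        linear_combination h
      rw [sum_eq] at h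
      have hac : a ^ 4 = c ^ 4 :=
        Nat.eq_of_mul_eq_mul_left (by positivity) (Nat.add_left_cancel h)
      have hbd : b ^ 4 = d ^ 4 := by omega
      exact ⟨Nat.pow_left_injective (by norm_num) hac, Nat.pow_left_injective (by norm_num) hbd⟩

/-- An element of `Λ` can be written over any sufficiently large power of `5`. -/
theorem exists_numerator_of_mem_Lambda {q : ℚ} (hq : q ∈ Lambda) :
    ∃ k : ℕ, ∀ n, k ≤ n → ∃ a : ℕ, a < 5 ^ n ∧ q = (a : ℚ) / 5 ^ n := by
  obtain ⟨a, k, ha, rfl⟩ := hq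
  refine ⟨k, fun n hn => ?_⟩
  obtain ⟨m, rfl⟩ := Nat.exists_eq_add_of_le hn
  refine ⟨a * 5 ^ m, ?_, ?_⟩
  · rw [pow_add]
    gcongr
  · push_cast
    rw [pow_add, mul_div_mul_right _ _ (by positivity)]

/-- The function `f(x, y) = (x⁴ + y⁴)³ + x⁴` is injective on `Λ × Λ`. -/
theorem f_injective_on_Lambda (x y x' y' : ℚ)
    (hx : x ∈ Lambda) (hy : y ∈ Lambda) (hx' : x' ∈ Lambda) (hy' : y' ∈ Lambda)
    (h : (x ^ 4 + y ^ 4) ^ 3 + x ^ 4 = (x' ^ 4 + y' ^ 4) ^ 3 + x' ^ 4) :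
    x = x' ∧ y = y' := by
  obtain ⟨k₁, h₁⟩ := exists_numerator_of_mem_Lambda hx
  obtain ⟨k₂, h₂⟩ := exists_numerator_of_mem_Lambda hy
  obtain ⟨k₃, h₃⟩ := exists_numerator_of_mem_Lambda hx'
  obtain ⟨k₄, h₄⟩ := exists_numerator_of_mem_Lambda hy'
  obtain ⟨n, hn⟩ : ∃ n, n = k₁ + k₂ + k₃ + k₄ := ⟨_, rfl⟩
  obtain ⟨a, ha, rfl⟩ := h₁ n (by omega)
  obtain ⟨b, hb, rfl⟩ := h₂ n (by omega)
  obtain ⟨c, hc, rfl⟩ := h₃ n (by omega)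
  obtain ⟨d, hd, rfl⟩ := h₄ n (by omega)
  have cleared : (a ^ 4 + b ^ 4) ^ 3 + 5 ^ (8 * n) * a ^ 4 =
      (c ^ 4 + d ^ 4) ^ 3 + 5 ^ (8 * n) * c ^ 4 := by
    rw [mul_comm 8 n, pow_mul]
    have h5 : (5 : ℚ) ^ n ≠ 0 := by positivity
    have : (((a : ℚ) ^ 4 + b ^ 4) ^ 3 + (5 ^ n) ^ 8 * a ^ 4) =
        ((c : ℚ) ^ 4 + d ^ 4) ^ 3 + (5 ^ n) ^ 8 * c ^ 4 := by
      generalize (5 : ℚ) ^ n = t at h h5 ⊢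
      field_simp at h
      linear_combination h
    exact_mod_cast this
  obtain ⟨rfl, rfl⟩ := eq_of_cleared_equation n ha hb hc hd cleared
  exact ⟨rfl, rfl⟩
end

section
/- The function ℕ → ℝ defined by k ↦ cos(k·arccos(3/5))² is injective; that is, if cos(k·θ)² = cos(k'·θ)² with θ = arccos(3/5) and k, k' ∈ ℕ, then k = k'. -/
theorem exists_int_five_pow_mul_cos_sin (k : ℕ) :
    ∃ c s : ℤ, (c : ℝ) = 5 ^ (k + 1) * Real.cos ((k + 1 : ℕ) * Real.arccos (3 / 5)) ∧
      (s : ℝ) = 5 ^ (k + 1) * Real.sin ((k + 1 : ℕ) * Real.arccos (3 / 5)) ∧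
      c % 5 = 3 ∧ s % 5 = 4 := by
  have hcos : Real.cos (Real.arccos (3 / 5)) = 3 / 5 :=
    Real.cos_arccos (by norm_num) (by norm_num)
  have hsin : Real.sin (Real.arccos (3 / 5)) = 4 / 5 := by
    rw [Real.sin_arccos, show (1 : ℝ) - (3 / 5) ^ 2 = (4 / 5) ^ 2 by norm_num]
    exact Real.sqrt_sq (by norm_num)
  induction k with
  | zero => exact ⟨3, 4, by norm_num [hcos], by norm_num [hsin], by norm_num, by norm_num⟩
  | succ k ih =>
    obtain ⟨c, s, hc, hs, hc5, hs5⟩ := ih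
    have hadd : ((k + 1 + 1 : ℕ) : ℝ) * Real.arccos (3 / 5) =
        (k + 1 : ℕ) * Real.arccos (3 / 5) + Real.arccos (3 / 5) := by
      push_cast; ring
    refine ⟨3 * c - 4 * s, 4 * c + 3 * s, ?_, ?_, by lia, by lia⟩
    · rw [hadd, Real.cos_add, hcos, hsin]
      push_cast [hc, hs]; ring
    · rw [hadd, Real.sin_add, hcos, hsin]
      push_cast [hc, hs]; ring

theorem exists_int_five_pow_mul_cos (k : ℕ) :
    ∃ c : ℤ, (c : ℝ) = 5 ^ k * Real.cos (k * Real.arccos (3 / 5)) ∧ (k ≠ 0 → ¬ 5 ∣ c) := by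
  cases k with
  | zero => exact ⟨1, by simp, by simp⟩
  | succ k =>
    obtain ⟨c, -, hc, -, hc5, -⟩ := exists_int_five_pow_mul_cos_sin k
    exact ⟨c, hc, fun _ => by lia⟩

theorem cos_sq_arccos_ne_of_lt {k m : ℕ} (h : k < m) :
    Real.cos (k * Real.arccos (3 / 5)) ^ 2 ≠ Real.cos (m * Real.arccos (3 / 5)) ^ 2 := by
  intro heq
  obtain ⟨c, hc, -⟩ := exists_int_five_pow_mul_cos k
  obtain ⟨d, hd, hd5⟩ := exists_int_five_pow_mul_cos m
  obtain ⟨j, rfl⟩ := Nat.exists_eq_add_of_lt h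
  have hdc : d ^ 2 = 5 * (5 * (5 ^ j * c) ^ 2) := by
    have : (d : ℝ) ^ 2 = 5 * (5 * (5 ^ j * c) ^ 2) := by
      rw [hd, mul_pow, ← heq, hc]; ring
    exact_mod_cast this
  exact hd5 (by lia)
    ((Nat.prime_iff_prime_int.mp Nat.prime_five).dvd_of_dvd_pow (Dvd.intro _ hdc.symm))

/-- The function `k ↦ cos(k · arccos(3/5))²` on the natural numbers
is injective. -/
theorem cos_sq_arccos_injective :
    Function.Injective (fun k : ℕ => (Real.cos (k * Real.arccos (3 / 5))) ^ 2) := by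
  intro k m h
  rcases lt_trichotomy k m with hlt | heq | hgt
  · exact absurd h (cos_sq_arccos_ne_of_lt hlt)
  · exact heq
  · exact absurd h.symm (cos_sq_arccos_ne_of_lt hgt)
end

section
/- The set { cos(k·arccos(3/5))² : k ∈ ℕ } is dense in the interval [0, 1]. -/
theorem irrational_arccos_div_two_pi {x : ℝ} (hx : x ∈ Set.Icc (-1) 1) (hq : ∃ q : ℚ, x = q)
    (hx' : x ∉ ({-1, -1 / 2, 0, 1 / 2, 1} : Set ℝ)) :
    Irrational (Real.arccos x / (2 * Real.pi)) := by
  rintro ⟨r, hr⟩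
  have hcos := Real.cos_arccos hx.1 hx.2
  have h : ∃ r : ℚ, Real.arccos x = r * Real.pi := by
    refine ⟨2 * r, ?_⟩
    have := Real.pi_ne_zero
    push_cast
    rw [hr]
    field_simp
  exact hx' (hcos ▸ niven h (hcos.symm ▸ hq))

theorem denseRange_nsmul_coe_angle {θ : ℝ} (hθ : Irrational (θ / (2 * Real.pi))) :
    DenseRange fun k : ℕ => ((k * θ : ℝ) : Real.Angle) := by
  have : Fact (0 < 2 * Real.pi) := ⟨Real.two_pi_pos⟩
  have h : DenseRange fun k : ℕ => k • (θ : AddCircle (2 * Real.pi)) :=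
    denseRange_zsmul_iff_nsmul.1 (AddCircle.denseRange_zsmul_coe_iff.2 hθ)
  simp only [← nsmul_eq_mul]
  exact h

theorem Icc_subset_closure_range_cos_sq {θ : ℝ} (hθ : Irrational (θ / (2 * Real.pi))) :
    Set.Icc (0 : ℝ) 1 ⊆ closure (Set.range fun k : ℕ => Real.cos (k * θ) ^ 2) := by
  intro y hy
  have hcont : Continuous fun a : Real.Angle => a.cos ^ 2 := Real.Angle.continuous_cos.pow 2
  have hy' : y = Real.cos (Real.arccos √y) ^ 2 := by
    rw [Real.cos_arccos (by linarith [Real.sqrt_nonneg y]) (Real.sqrt_le_one.2 hy.2),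
      Real.sq_sqrt hy.1]
  have hmem := hcont.range_subset_closure_image_dense (denseRange_nsmul_coe_angle hθ)
    (Set.mem_range_self (Real.arccos √y : Real.Angle))
  rw [← Set.range_comp] at hmem
  rw [hy']
  exact hmem

/-- The set `{ cos(k · arccos(3/5))² : k ∈ ℕ }` is dense in `[0, 1]`. -/
theorem cos_sq_arccos_dense :
    Set.Icc (0 : ℝ) 1 ⊆
      closure (Set.range fun k : ℕ => (Real.cos (k * Real.arccos (3 / 5))) ^ 2) := by
  refine Icc_subset_closure_range_cos_sq (irrational_arccos_div_two_pi ?_ ⟨3 / 5, ?_⟩ ?_) <;>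
    norm_num
end
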